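/- Let G be a finite d-regular simple graph with g vertices and adjacency matrix A having eigenvalues α₁,…,α_g, where d ≥ 3, and for k ≥ 2 let w_k be the number of closed non-backtracking k-walks in G. Then the series Σ_{k≥2} w_k / (2k (d−1)^{2k}) converges, and exp(Σ_{k≥2} w_k / (2k (d−1)^{2k})) = (d−1)^{dg − g/2} · ((d−1)⁴ − 1)^{−(d−2)g/4} · Π_{i=1}^g ((d−1)³ + 1 − (d−1)α_i)^{−1/2}. -/

import Mathlib

open Polynomial in
theorem Matrix.det_aeval_eq_prod_roots_charpoly {n K : Type*} [Fintype n] [DecidableEq n]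
    [Field K] [IsAlgClosed K] (M : Matrix n n K) (p : K[X]) :
    (aeval M p).det = (M.charpoly.roots.map fun z => p.eval z).prod := by
  have hc : M.charpoly.roots.card = Fintype.card n := by
    rw [← M.charpoly_natDegree_eq_dim, (IsAlgClosed.splits M.charpoly).natDegree_eq_card_roots]
  have hchar : ∀ r : K, (aeval M (X - C r)).det
      = (M.charpoly.roots.map fun z => (X - C r).eval z).prod := by
    intro r
    have h1 : aeval M (X - C r) = -(Matrix.scalar n r - M) := by
      simp [Matrix.algebraMap_eq_diagonal, Matrix.scalar_apply, Pi.algebraMap_def]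
    have hs := (IsAlgClosed.splits M.charpoly).eq_prod_roots_of_monic M.charpoly_monic
    rw [h1, Matrix.det_neg, ← Matrix.eval_charpoly, ← hc]
    conv_lhs => rw [hs]
    rw [eval_multiset_prod, Multiset.map_map]
    have h2 := (M.charpoly.roots.map fun z => r - z).prod_map_neg
    rw [Multiset.map_map, Multiset.card_map] at h2
    simpa [Function.comp_def] using h2.symm
  rw [(IsAlgClosed.splits p).eq_prod_roots]
  induction p.roots using Multiset.induction_on with
  | empty => simp [Matrix.algebraMap_eq_diagonal, Pi.algebraMap_def, hc]
  | cons r s ih =>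
    rw [Multiset.map_cons, Multiset.prod_cons, mul_left_comm, map_mul, Matrix.det_mul, ih, hchar,
      ← Multiset.prod_map_mul]
    simp only [eval_mul]

open Polynomial in
theorem Matrix.trace_pow_eq_sum_roots_charpoly {n K : Type*} [Fintype n] [DecidableEq n]
    [Field K] [IsAlgClosed K] (M : Matrix n n K) (k : ℕ) :
    (M ^ k).trace = (M.charpoly.roots.map fun z => z ^ k).sum := by
  have hchar : (M ^ k).charpoly
      = ((M.charpoly.roots.map fun z => z ^ k).map fun z => X - C z).prod := by
    have := IsAlgClosed.instInfinite (K := K)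
    refine Polynomial.funext fun x => ?_
    have h := M.det_aeval_eq_prod_roots_charpoly (C x - X ^ k)
    simp only [eval_sub, eval_C, eval_pow, eval_X, map_sub, aeval_C, map_pow, aeval_X] at h
    rw [Matrix.eval_charpoly, eval_multiset_prod, Multiset.map_map, Multiset.map_map]
    simpa [Function.comp_def, Matrix.algebraMap_eq_diagonal, Pi.algebraMap_def] using h
  rw [Matrix.trace_eq_sum_roots_charpoly, hchar, Polynomial.roots_multiset_prod_X_sub_C]

theorem exists_hasSum_pow_div_of_norm_lt_one (s : Multiset ℂ) (hs : ∀ z ∈ s, ‖z‖ < 1) :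
    ∃ L : ℂ, HasSum (fun k : ℕ => (s.map fun z => z ^ k).sum / k) L ∧
      Complex.exp L * (s.map fun z => 1 - z).prod = 1 := by
  induction s using Multiset.induction_on with
  | empty => exact ⟨0, by simp, by simp⟩
  | cons a s ih =>
    obtain ⟨L, hL, hexp⟩ := ih fun z hz => hs z (Multiset.mem_cons_of_mem hz)
    have ha : ‖a‖ < 1 := hs a (Multiset.mem_cons_self a s)
    have hne : 1 - a ≠ 0 := by
      intro h
      rw [← sub_eq_zero.1 h] at ha
      simp at ha
    refine ⟨-Complex.log (1 - a) + L, ?_, ?_⟩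
    · simpa [add_div] using (Complex.hasSum_taylorSeries_neg_log ha).add hL
    · rw [Complex.exp_add, Complex.exp_neg, Complex.exp_log hne, Multiset.map_cons,
        Multiset.prod_cons]
      field_simp
      linear_combination hexp

open Polynomial in
theorem Matrix.exists_hasSum_trace_pow_div {n : Type*} [Fintype n] [DecidableEq n]
    (M : Matrix n n ℝ) (hM : ∀ i, ∑ j, |M i j| < 1) :
    ∃ S : ℝ, HasSum (fun k : ℕ => (M ^ k).trace / k) S ∧ Real.exp S * (1 - M).det = 1 := by
  set Z : Matrix n n ℂ := M.map Complex.ofRealHom with hZ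
  have hroots : ∀ z ∈ Z.charpoly.roots, ‖z‖ < 1 := by
    intro z hz
    have hev : Module.End.HasEigenvalue (Matrix.toLin' Z) z := by
      rw [Module.End.hasEigenvalue_iff_isRoot_charpoly, Matrix.charpoly_toLin']
      exact isRoot_of_mem_roots hz
    obtain ⟨i, hi⟩ := eigenvalue_mem_ball hev
    rw [mem_closedBall_iff_norm] at hi
    calc ‖z‖ ≤ ‖z - Z i i‖ + ‖Z i i‖ := by simpa using norm_add_le (z - Z i i) (Z i i)
      _ ≤ ∑ j ∈ Finset.univ.erase i, ‖Z i j‖ + ‖Z i i‖ := by gcongr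
      _ = ∑ j, ‖Z i j‖ := Finset.sum_erase_add _ _ (Finset.mem_univ i)
      _ = ∑ j, |M i j| := by simp [hZ]
      _ < 1 := hM i
  obtain ⟨L, hL, hexp⟩ := exists_hasSum_pow_div_of_norm_lt_one _ hroots
  have htr : ∀ k : ℕ, (Z.charpoly.roots.map fun z => z ^ k).sum / k
      = (((M ^ k).trace / k : ℝ) : ℂ) := by
    intro k
    rw [← Matrix.trace_pow_eq_sum_roots_charpoly, hZ, ← Matrix.map_pow]
    simp [Matrix.trace]
  have hdet : (Z.charpoly.roots.map fun z => 1 - z).prod = (((1 - M).det : ℝ) : ℂ) := by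
    have h := Z.det_aeval_eq_prod_roots_charpoly (1 - X)
    simp only [eval_sub, eval_one, eval_X, map_sub, map_one, aeval_X] at h
    rw [← h, ← Complex.ofRealHom_eq_coe, RingHom.map_det]
    simp [hZ, RingHom.mapMatrix_apply, Matrix.map_sub]
  simp only [htr] at hL
  have hre := Complex.hasSum_re hL
  simp only [Complex.ofReal_re] at hre
  have hLre : ((L.re : ℝ) : ℂ) = L := (Complex.hasSum_ofReal.2 hre).unique hL
  refine ⟨L.re, hre, ?_⟩
  rw [hdet, ← hLre] at hexp
  exact_mod_cast hexp

theorem Matrix.pow_succ_apply_eq_sum_prod {n R : Type*} [Fintype n] [DecidableEq n]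
    [CommSemiring R] (M : Matrix n n R) (k : ℕ) (i j : n) :
    (M ^ (k + 1)) i j = ∑ p : Fin k → n,
      (∏ l : Fin k, M (Fin.cons (α := fun _ => n) i p l.castSucc) (p l)) *
        M (Fin.cons (α := fun _ => n) i p (Fin.last k)) j := by
  induction k generalizing i with
  | zero => simp
  | succ k ih =>
    rw [pow_succ', Matrix.mul_apply, ← (Fin.consEquiv fun _ => n).sum_comp, Fintype.sum_prod_type]
    refine Finset.sum_congr rfl fun x _ => ?_
    rw [ih, Finset.mul_sum]
    refine Finset.sum_congr rfl fun p _ => ?_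
    rw [Fin.prod_univ_succ]
    simp [Fin.consEquiv, ← Fin.succ_castSucc, ← Fin.succ_last, mul_assoc, -Fin.castSucc_succ]

theorem Matrix.trace_pow_succ_eq_sum_prod {n R : Type*} [Fintype n] [DecidableEq n]
    [CommSemiring R] (M : Matrix n n R) (k : ℕ) :
    (M ^ (k + 1)).trace = ∑ p : Fin (k + 1) → n, ∏ l, M (p l) (p (l + 1)) := by
  rw [← (Fin.consEquiv fun _ => n).sum_comp, Fintype.sum_prod_type, Matrix.trace]
  refine Finset.sum_congr rfl fun i _ => ?_
  rw [Matrix.diag_apply, Matrix.pow_succ_apply_eq_sum_prod]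
  refine Finset.sum_congr rfl fun p _ => ?_
  rw [Fin.prod_univ_castSucc]
  simp [Fin.consEquiv]

namespace SimpleGraph

variable {V : Type*} (G : SimpleGraph V)

variable {G} in
theorem Dart.eq_symm_iff {e f : G.Dart} : f = e.symm ↔ f.fst = e.snd ∧ f.snd = e.fst := by
  rw [Dart.ext_iff, Prod.ext_iff]
  rfl

theorem card_dart_of_isRegularOfDegree [Fintype V] [DecidableRel G.Adj] {d : ℕ}
    (hreg : G.IsRegularOfDegree d) : Fintype.card G.Dart = Fintype.card V * d := by
  rw [G.dart_card_eq_sum_degrees]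
  simp [hreg.degree_eq]

variable [DecidableEq V]

/-- The Hashimoto matrix: `e` is followed by `f` if `f` starts where `e` ends and `f` is not the
reversal of `e`. -/
def nonBacktrackingMatrix (R : Type*) [Zero R] [One R] : Matrix G.Dart G.Dart R :=
  Matrix.of fun e f => if e.snd = f.fst ∧ f.snd ≠ e.fst then 1 else 0

/-- The permutation matrix of dart reversal. -/
def dartSymmMatrix (R : Type*) [Zero R] [One R] : Matrix G.Dart G.Dart R :=
  Matrix.of fun e f => if f = e.symm then 1 else 0

/-- The incidence matrix of darts and their initial vertices. -/
def dartFstMatrix (R : Type*) [Zero R] [One R] : Matrix G.Dart V R :=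
  Matrix.of fun e v => if e.fst = v then 1 else 0

/-- The incidence matrix of darts and their terminal vertices. -/
def dartSndMatrix (R : Type*) [Zero R] [One R] : Matrix G.Dart V R :=
  Matrix.of fun e v => if e.snd = v then 1 else 0

theorem nonBacktrackingMatrix_eq_sub [Fintype V] (R : Type*) [Ring R] :
    G.nonBacktrackingMatrix R =
      G.dartSndMatrix R * (G.dartFstMatrix R).transpose - G.dartSymmMatrix R := by
  ext e f
  simp only [nonBacktrackingMatrix, dartSndMatrix, dartFstMatrix, dartSymmMatrix,
    Matrix.sub_apply, Matrix.mul_apply, Matrix.transpose_apply, Matrix.of_apply, ite_mul, one_mul,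
    zero_mul, Dart.eq_symm_iff, eq_comm (a := e.snd)]
  by_cases h1 : f.fst = e.snd <;> by_cases h2 : f.snd = e.fst <;> simp [h1, h2]

variable [Fintype V] [DecidableRel G.Adj]

theorem dartSymmMatrix_mul_self (R : Type*) [Ring R] :
    G.dartSymmMatrix R * G.dartSymmMatrix R = 1 := by
  ext e f
  simp only [dartSymmMatrix, Matrix.mul_apply, Matrix.of_apply, Matrix.one_apply, ite_mul, one_mul,
    zero_mul, Finset.sum_ite_eq', Finset.mem_univ, if_true, Dart.symm_symm, eq_comm (a := e)]

theorem dartSymmMatrix_mul_dartSndMatrix (R : Type*) [Ring R] :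
    G.dartSymmMatrix R * G.dartSndMatrix R = G.dartFstMatrix R := by
  ext e v
  simp only [dartSymmMatrix, dartSndMatrix, dartFstMatrix, Matrix.mul_apply, Matrix.of_apply,
    ite_mul, one_mul, zero_mul, Finset.sum_ite_eq', Finset.mem_univ, if_true]
  rfl

theorem sum_dart_fst_eq {R : Type*} [NonAssocSemiring R] (v : V) :
    ∑ e : G.Dart, (if e.fst = v then (1 : R) else 0) = G.degree v := by
  rw [Finset.sum_boole, ← G.dart_fst_fiber_card_eq_degree v]

theorem dartFstMatrix_transpose_mul_dartSndMatrix (R : Type*) [Ring R] :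
    (G.dartFstMatrix R).transpose * G.dartSndMatrix R = G.adjMatrix R := by
  ext v w
  simp only [dartFstMatrix, dartSndMatrix, Matrix.mul_apply, Matrix.transpose_apply,
    Matrix.of_apply, adjMatrix_apply, ite_mul, one_mul, zero_mul, ← ite_and]
  by_cases h : G.Adj v w
  · rw [Finset.sum_eq_single ⟨(v, w), h⟩]
    · simp [h]
    · rintro e - he
      refine if_neg fun h' => he (Dart.ext _ _ (Prod.ext h'.1 h'.2))
    · simp
  · rw [if_neg h]
    refine Finset.sum_eq_zero fun e _ => if_neg ?_
    rintro ⟨rfl, rfl⟩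
    exact h e.adj

theorem dartFstMatrix_transpose_mul_self (R : Type*) [Ring R] {d : ℕ}
    (hreg : G.IsRegularOfDegree d) :
    (G.dartFstMatrix R).transpose * G.dartFstMatrix R = (d : R) • (1 : Matrix V V R) := by
  ext v w
  simp only [dartFstMatrix, Matrix.mul_apply, Matrix.transpose_apply,
    Matrix.of_apply, Matrix.smul_apply, Matrix.one_apply, ite_mul, one_mul, zero_mul, ← ite_and]
  by_cases h : v = w
  · subst h
    simp [G.sum_dart_fst_eq v, hreg v]
  · rw [if_neg h, smul_zero]
    refine Finset.sum_eq_zero fun e _ => if_neg ?_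
    rintro ⟨rfl, rfl⟩
    exact h rfl

theorem sum_abs_nonBacktrackingMatrix {d : ℕ} (hreg : G.IsRegularOfDegree d) (e : G.Dart) :
    ∑ f, |G.nonBacktrackingMatrix ℝ e f| = d - 1 := by
  have h : ∀ f, |G.nonBacktrackingMatrix ℝ e f| =
      (if f.fst = e.snd then 1 else 0) - (if f = e.symm then 1 else 0) := by
    intro f
    simp only [nonBacktrackingMatrix, Matrix.of_apply, Dart.eq_symm_iff, eq_comm (a := e.snd)]
    by_cases h1 : f.fst = e.snd <;> by_cases h2 : f.snd = e.fst <;> simp [h1, h2]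
  simp only [h, Finset.sum_sub_distrib, G.sum_dart_fst_eq, hreg.degree_eq]
  simp

/-- An orientation conjugates the reversal matrix to its negative. -/
theorem det_one_sub_smul_dartSymmMatrix {R : Type*} [CommRing R] (u : R) :
    (1 - u • G.dartSymmMatrix R).det = (1 + u • G.dartSymmMatrix R).det := by
  let φ := Fintype.equivFin V
  let s : G.Dart → R := fun e => if φ e.fst < φ e.snd then 1 else -1
  have hs : ∀ e, s e * s e = 1 := fun e => by by_cases h : φ e.fst < φ e.snd <;> simp [s, h]
  have hsymm : ∀ e : G.Dart, s e.symm = - s e := by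
    intro e
    have hne : φ e.fst ≠ φ e.snd := fun h => e.fst_ne_snd (φ.injective h)
    rcases lt_or_gt_of_ne hne with h | h
    · simp [s, h, h.not_gt]
    · simp [s, h, h.not_gt]
  have hconj : Matrix.diagonal s * (1 + u • G.dartSymmMatrix R) * Matrix.diagonal s
      = 1 - u • G.dartSymmMatrix R := by
    ext e f
    rw [Matrix.mul_diagonal, Matrix.diagonal_mul]
    by_cases hef : e = f
    · subst hef
      have hne : e ≠ e.symm := e.symm_ne.symm
      simp [dartSymmMatrix, hne, hs]
    · by_cases hf : f = e.symm
      · subst hf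
        simp only [Matrix.add_apply, Matrix.sub_apply, Matrix.one_apply_ne hef, Matrix.smul_apply,
          dartSymmMatrix, Matrix.of_apply, if_true, hsymm, smul_eq_mul]
        linear_combination (-u) * hs e
      · simp [dartSymmMatrix, hef, hf]
  have hdet : (Matrix.diagonal s).det * (Matrix.diagonal s).det = 1 := by
    rw [← Matrix.det_mul, Matrix.diagonal_mul_diagonal]
    simp [hs]
  rw [← hconj, Matrix.det_mul, Matrix.det_mul]
  linear_combination (1 + u • G.dartSymmMatrix R).det * hdet

theorem one_add_smul_mul_one_sub_smul_dartSymmMatrix {R : Type*} [CommRing R] (u : R) :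
    (1 + u • G.dartSymmMatrix R) * (1 - u • G.dartSymmMatrix R)
      = (1 - u ^ 2) • (1 : Matrix G.Dart G.Dart R) := by
  rw [mul_sub, mul_one, add_mul, one_mul, smul_mul_smul_comm, dartSymmMatrix_mul_self, sub_smul,
    one_smul, ← pow_two]
  abel

theorem det_one_add_smul_dartSymmMatrix_sq {R : Type*} [CommRing R] (u : R) :
    (1 + u • G.dartSymmMatrix R).det ^ 2 = (1 - u ^ 2) ^ Fintype.card G.Dart := by
  have h := congrArg Matrix.det (G.one_add_smul_mul_one_sub_smul_dartSymmMatrix u)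
  rwa [Matrix.det_mul, det_one_sub_smul_dartSymmMatrix, Matrix.det_smul, Matrix.det_one, mul_one,
    ← pow_two] at h

/-- A form of the Ihara–Bass determinant formula. -/
theorem det_one_sub_smul_nonBacktrackingMatrix {K : Type*} [Field K] {d : ℕ}
    (hreg : G.IsRegularOfDegree d) (u : K) (hu : 1 - u ^ 2 ≠ 0) :
    (1 - u • G.nonBacktrackingMatrix K).det = (1 + u • G.dartSymmMatrix K).det *
      (1 - (u / (1 - u ^ 2)) • (G.adjMatrix K - (u * d) • (1 : Matrix V V K))).det := by
  set c := u / (1 - u ^ 2) with hc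
  have hcu : c * (1 - u ^ 2) = u := div_mul_cancel₀ _ hu
  have hfac : 1 - u • G.nonBacktrackingMatrix K = (1 + u • G.dartSymmMatrix K) *
      (1 - (c • ((1 - u • G.dartSymmMatrix K) * G.dartSndMatrix K)) *
        (G.dartFstMatrix K).transpose) := by
    rw [mul_sub, mul_one, ← Matrix.mul_assoc, Matrix.mul_smul, ← Matrix.mul_assoc,
      one_add_smul_mul_one_sub_smul_dartSymmMatrix, Matrix.smul_mul, Matrix.smul_mul, Matrix.one_mul,
      Matrix.smul_mul, smul_smul, hcu, nonBacktrackingMatrix_eq_sub, smul_sub]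
    abel
  rw [hfac, Matrix.det_mul, Matrix.det_one_sub_mul_comm, Matrix.mul_smul, Matrix.sub_mul, Matrix.one_mul,
    Matrix.smul_mul, dartSymmMatrix_mul_dartSndMatrix, Matrix.mul_sub, Matrix.mul_smul,
    dartFstMatrix_transpose_mul_dartSndMatrix, dartFstMatrix_transpose_mul_self _ _ hreg, smul_smul]

/-- Closed non-backtracking walks correspond to cyclic sequences of darts. -/
def closedNonBacktrackingEquiv (k : ℕ) :
    {v : ZMod k → V // ∀ j : ZMod k, G.Adj (v j) (v (j + 1)) ∧ v (j + 2) ≠ v j} ≃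
      {p : ZMod k → G.Dart // ∀ j, (p j).snd = (p (j + 1)).fst ∧ (p (j + 1)).snd ≠ (p j).fst} where
  toFun v := ⟨fun j => ⟨(v.1 j, v.1 (j + 1)), (v.2 j).1⟩, fun j => ⟨rfl, by
    change v.1 (j + 1 + 1) ≠ v.1 j
    rw [add_assoc, one_add_one_eq_two]
    exact (v.2 j).2⟩⟩
  invFun p := ⟨fun j => (p.1 j).fst, fun j => ⟨by
      have h := (p.1 j).adj
      rwa [(p.2 j).1] at h, by
      have h := (p.2 j).2
      rwa [(p.2 (j + 1)).1, add_assoc, one_add_one_eq_two] at h⟩⟩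
  left_inv v := rfl
  right_inv p := Subtype.ext <| funext fun j => Dart.ext _ _ <| Prod.ext rfl (p.2 j).1.symm

theorem trace_nonBacktrackingMatrix_pow {R : Type*} [CommSemiring R] {k : ℕ} (hk : k ≠ 0) :
    (G.nonBacktrackingMatrix R ^ k).trace = Nat.card {v : ZMod k → V //
      ∀ j : ZMod k, G.Adj (v j) (v (j + 1)) ∧ v (j + 2) ≠ v j} := by
  obtain ⟨k, rfl⟩ := Nat.exists_eq_succ_of_ne_zero hk
  rw [Nat.card_congr (G.closedNonBacktrackingEquiv (k + 1)), Matrix.trace_pow_succ_eq_sum_prod]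
  change _ = ((Nat.card {p : Fin (k + 1) → G.Dart // ∀ j, (p j).snd = (p (j + 1)).fst ∧
    (p (j + 1)).snd ≠ (p j).fst} : ℕ) : R)
  rw [Nat.card_eq_fintype_card, Fintype.card_subtype, ← Finset.sum_boole]
  refine Finset.sum_congr rfl fun p _ => ?_
  simp [nonBacktrackingMatrix, Finset.prod_ite_zero]

theorem charpoly_adjMatrix_root_le {d : ℕ} (hreg : G.IsRegularOfDegree d) {a : ℝ}
    (ha : (G.adjMatrix ℝ).charpoly.IsRoot a) : a ≤ d := by
  have hev : Module.End.HasEigenvalue (Matrix.toLin' (G.adjMatrix ℝ)) a := by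
    rwa [Module.End.hasEigenvalue_iff_isRoot_charpoly, Matrix.charpoly_toLin']
  obtain ⟨v, hv⟩ := eigenvalue_mem_ball hev
  rw [mem_closedBall_iff_norm] at hv
  have hsum : ∑ w ∈ Finset.univ.erase v, ‖G.adjMatrix ℝ v w‖ ≤ d := by
    calc _ ≤ ∑ w, ‖G.adjMatrix ℝ v w‖ :=
          Finset.sum_le_sum_of_subset_of_nonneg (Finset.erase_subset _ _) fun _ _ _ => norm_nonneg _
      _ = ∑ w, if G.Adj v w then (1 : ℝ) else 0 := by
          refine Finset.sum_congr rfl fun w _ => ?_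
          by_cases h : G.Adj v w <;> simp [h]
      _ = d := by
          rw [Finset.sum_boole, ← hreg.degree_eq v, ← G.card_neighborFinset_eq_degree,
            G.neighborFinset_eq_filter]
  have := (le_abs_self _).trans (hv.trans hsum)
  simpa using this

end SimpleGraph

open Polynomial in
/-- For a finite `d`-regular simple graph `G` (`d ≥ 3`) on `g` vertices whose
adjacency matrix has eigenvalues `α₁,…,α_g`, and with `w_k` the number of closed
non-backtracking `k`-walks, the series `∑_{k≥2} w_k/(2k(d−1)^{2k})` converges and
`exp(∑_{k≥2} w_k/(2k(d−1)^{2k})) =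
  (d−1)^{dg−g/2} ((d−1)⁴−1)^{−(d−2)g/4} ∏ᵢ ((d−1)³+1−(d−1)αᵢ)^{−1/2}`. -/
theorem stmt_17 {V : Type*} [Fintype V] [DecidableEq V] (G : SimpleGraph V)
    [DecidableRel G.Adj] (d g : ℕ) (hd : 3 ≤ d)
    (hreg : G.IsRegularOfDegree d) (hg : Fintype.card V = g)
    (α : Fin g → ℝ)
    (hα : (G.adjMatrix ℝ).charpoly = ∏ i, (X - C (α i)))
    (w : ℕ → ℕ)
    (hw : ∀ k : ℕ, 2 ≤ k → w k = Nat.card {v : ZMod k → V //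
        ∀ j : ZMod k, G.Adj (v j) (v (j + 1)) ∧ v (j + 2) ≠ v j})
    (f : ℕ → ℝ)
    (hf : ∀ k : ℕ, f k =
      if 2 ≤ k then (w k : ℝ) / (2 * k * ((d:ℝ) - 1) ^ (2 * k)) else 0) :
    Summable f ∧
    Real.exp (∑' k, f k) =
      ((d:ℝ) - 1) ^ ((d * g : ℝ) - (g:ℝ)/2) *
        (((d:ℝ) - 1) ^ 4 - 1) ^ (-(((d:ℝ) - 2) * g / 4)) *
        ∏ i : Fin g, (((d:ℝ) - 1) ^ 3 + 1 - ((d:ℝ) - 1) * α i) ^ (-(1/2 : ℝ)) := by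
  have hq2 : (2 : ℝ) ≤ (d : ℝ) - 1 := by
    have : (3 : ℝ) ≤ d := by exact_mod_cast hd
    linarith
  have hdq : (d : ℝ) = (d : ℝ) - 1 + 1 := by ring
  have hroot : ∀ i, α i ≤ d := fun i => G.charpoly_adjMatrix_root_le hreg (by
    rw [hα, IsRoot, eval_prod]
    exact Finset.prod_eq_zero (Finset.mem_univ i) (by simp))
  have hB := G.sum_abs_nonBacktrackingMatrix hreg
  have hcard : (Fintype.card G.Dart : ℝ) = d * g := by
    rw [G.card_dart_of_isRegularOfDegree hreg, hg]
    push_cast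
    ring
  generalize hq : (d : ℝ) - 1 = q at *
  have hq0 : 0 < q := by linarith
  have hq4 : 0 < q ^ 4 - 1 := by nlinarith [sq_nonneg (q ^ 2 - 4), mul_self_nonneg (q - 2)]
  have hy : ∀ i, 0 < q ^ 3 + 1 - q * α i := fun i => by
    have h1 : q * α i ≤ q * d := mul_le_mul_of_nonneg_left (hroot i) hq0.le
    rw [hdq] at h1
    nlinarith [mul_nonneg hq0.le (sub_nonneg.2 hq2), mul_nonneg (sq_nonneg q) (sub_nonneg.2 hq2)]
  have hu : 1 - (1 / q ^ 2) ^ 2 = (q ^ 4 - 1) / q ^ 4 := by field_simp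
  obtain ⟨S, hS, hexp⟩ :=
    ((1 / q ^ 2) • G.nonBacktrackingMatrix ℝ).exists_hasSum_trace_pow_div (fun e => by
      simp only [Matrix.smul_apply, smul_eq_mul, abs_mul, ← Finset.mul_sum, hB e]
      rw [abs_of_pos (by positivity), div_mul_eq_mul_div, one_mul, div_lt_one (by positivity)]
      nlinarith)
  have hfS : HasSum f (S / 2) := by
    refine (hS.div_const 2).congr_fun fun k => ?_
    rw [hf k, _root_.smul_pow, Matrix.trace_smul, smul_eq_mul]
    rcases Nat.lt_or_ge k 2 with hk | hk
    · rw [if_neg hk.not_ge]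
      interval_cases k
      · simp
      · simp [Matrix.trace, SimpleGraph.nonBacktrackingMatrix]
    · rw [if_pos hk, hw k hk, ← G.trace_nonBacktrackingMatrix_pow (R := ℝ) (by omega)]
      have hk0 : (k : ℝ) ≠ 0 := by positivity
      rw [one_div_pow, ← pow_mul]
      field_simp
  refine ⟨hfS.summable, ?_⟩
  rw [hfS.tsum_eq]
  have hAdet : (1 - (1 / q ^ 2 / (1 - (1 / q ^ 2) ^ 2)) •
      (G.adjMatrix ℝ - (1 / q ^ 2 * d) • (1 : Matrix V V ℝ))).det
      = (q / (q ^ 4 - 1)) ^ g * ∏ i, (q ^ 3 + 1 - q * α i) := by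
    have h1 : 1 - (1 / q ^ 2 / (1 - (1 / q ^ 2) ^ 2)) •
        (G.adjMatrix ℝ - (1 / q ^ 2 * d) • (1 : Matrix V V ℝ))
        = (q ^ 2 / (q ^ 4 - 1)) • (Matrix.scalar V (q ^ 2 + 1 / q) - G.adjMatrix ℝ) := by
      ext v w
      rw [hu, hdq]
      by_cases h : v = w
      · subst h
        simp
        field_simp
        ring
      · simp [h, Matrix.one_apply_ne h]
        field_simp
    rw [h1, Matrix.det_smul, ← Matrix.eval_charpoly, hα, eval_prod, hg]
    have h2 : ∀ i, eval (q ^ 2 + 1 / q) (X - C (α i)) = 1 / q * (q ^ 3 + 1 - q * α i) := by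
      intro i
      simp only [eval_sub, eval_X, eval_C]
      field_simp
    rw [Finset.prod_congr rfl fun i _ => h2 i, Finset.prod_mul_distrib, Finset.prod_const,
      Finset.card_univ, Fintype.card_fin, ← mul_assoc, ← mul_pow]
    congr 2
    field_simp
  rw [G.det_one_sub_smul_nonBacktrackingMatrix hreg _ (by rw [hu]; positivity), hAdet] at hexp
  have hJ := G.det_one_add_smul_dartSymmMatrix_sq (1 / q ^ 2)
  rw [hu] at hJ
  generalize (1 + (1 / q ^ 2) • G.dartSymmMatrix ℝ).det = P at hexp hJ
  have hprod : 0 < ∏ i, (q ^ 3 + 1 - q * α i) := Finset.prod_pos fun i _ => hy i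
  have hP : P ≠ 0 := by
    rintro rfl
    simp at hexp
  have hlogJ := congrArg Real.log hJ
  rw [Real.log_pow, Real.log_pow, Real.log_div hq4.ne' (by positivity), Real.log_pow, hcard]
    at hlogJ
  have hlog := congrArg Real.log hexp
  rw [Real.log_mul (by positivity) (by positivity), Real.log_exp, Real.log_mul hP (by positivity),
    Real.log_mul (by positivity) hprod.ne', Real.log_pow, Real.log_div hq0.ne' hq4.ne',
    Real.log_prod (fun i _ => (hy i).ne'), Real.log_one] at hlog
  have hlogy : ∑ i, Real.log ((q ^ 3 + 1 - q * α i) ^ (-(1 / 2 : ℝ)))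
      = -(1 / 2) * ∑ i, Real.log (q ^ 3 + 1 - q * α i) := by
    rw [Finset.mul_sum]
    exact Finset.sum_congr rfl fun i _ => Real.log_rpow (hy i) _
  have hy' : ∀ i, 0 < (q ^ 3 + 1 - q * α i) ^ (-(1 / 2 : ℝ)) := fun i =>
    Real.rpow_pos_of_pos (hy i) _
  have hprod' : 0 < ∏ i, (q ^ 3 + 1 - q * α i) ^ (-(1 / 2 : ℝ)) :=
    Finset.prod_pos fun i _ => hy' i
  rw [← Real.exp_log (x := _ * _) (by positivity)]
  congr 1
  rw [Real.log_mul (by positivity) hprod'.ne', Real.log_mul (by positivity) (by positivity),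
    Real.log_rpow hq0, Real.log_rpow hq4, Real.log_prod (fun i _ => (hy' i).ne'), hlogy]
  push_cast at hlogJ
  linear_combination (1 / 2) * hlog - (1 / 4) * hlogJ
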